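/- arXiv:2211.13797 — 2 statements merged into one kernel-verified Lean document; each statement's English description precedes it below -/
import Mathlib

section
/- Fix N ∈ ℕ, a finite set σ ⊆ Fin N of regions, a real power parameter a > 0, and nonnegative reals c_i ≥ 0 for i ∈ σ. For a matrix Y ∈ Matrix (Fin N) (Fin N) ℝ define the net inflow T_i(Y) = Σ_{j} Y j i − Σ_{j} Y i j. Then the charging-unfairness function J_E(Y) = Σ_{i ∈ σ} c_i / (T_i(Y))^a is convex on the convex set {Y | ∀ i ∈ σ, T_i(Y) > 0}. -/
theorem charging_aux (a : ℝ) (ha : 0 < a) {x y p q : ℝ} (hx : 0 < x) (hy : 0 < y)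
    (hp : 0 ≤ p) (hq : 0 ≤ q) (hpq : p + q = 1) :
    0 < p * x + q * y ∧ ((p * x + q * y) ^ a)⁻¹ ≤ p * (x ^ a)⁻¹ + q * (y ^ a)⁻¹ := by
  have hpos : 0 < p * x + q * y := by
    have h := (convex_Ioi (0 : ℝ)) (Set.mem_Ioi.2 hx) (Set.mem_Ioi.2 hy) hp hq hpq
    simpa using h
  refine ⟨hpos, ?_⟩
  have h1 := strictConcaveOn_log_Ioi.concaveOn.2 (Set.mem_Ioi.2 hx) (Set.mem_Ioi.2 hy) hp hq hpq
  have h2 := convexOn_exp.2 (Set.mem_univ (Real.log x * (-a)))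
    (Set.mem_univ (Real.log y * (-a))) hp hq hpq
  simp only [smul_eq_mul] at h1 h2
  rw [← Real.rpow_neg hpos.le, ← Real.rpow_neg hx.le, ← Real.rpow_neg hy.le,
    Real.rpow_def_of_pos hpos, Real.rpow_def_of_pos hx, Real.rpow_def_of_pos hy]
  refine le_trans (Real.exp_le_exp.2 ?_) h2
  nlinarith


/-- Fix `N`, a finite set `σ ⊆ Fin N` of regions, a power parameter `a > 0`, and
nonnegative reals `c i ≥ 0` for `i ∈ σ`. For a matrix `Y` define the net inflow
`T i Y = ∑ j, Y j i - ∑ j, Y i j`.  Then the charging-unfairness function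
`J_E(Y) = ∑ i ∈ σ, c i / (T i Y) ^ a` is convex on the convex set
`{Y | ∀ i ∈ σ, 0 < T i Y}`. -/
theorem convexOn_charging_unfairness (N : ℕ) (σ : Finset (Fin N)) (a : ℝ) (ha : 0 < a)
    (c : Fin N → ℝ) (hc : ∀ i ∈ σ, 0 ≤ c i) :
    ConvexOn ℝ
      {Y : Matrix (Fin N) (Fin N) ℝ | ∀ i ∈ σ, 0 < (∑ j, Y j i) - (∑ j, Y i j)}
      (fun Y : Matrix (Fin N) (Fin N) ℝ =>
        ∑ i ∈ σ, c i / ((∑ j, Y j i) - (∑ j, Y i j)) ^ a) := by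
  have key : ∀ (X Y : Matrix (Fin N) (Fin N) ℝ) (p q : ℝ) (i : Fin N),
      (∑ j, (p • X + q • Y) j i) - (∑ j, (p • X + q • Y) i j)
        = p * ((∑ j, X j i) - (∑ j, X i j)) + q * ((∑ j, Y j i) - (∑ j, Y i j)) := by
    intro X Y p q i
    simp only [Matrix.add_apply, Matrix.smul_apply, smul_eq_mul, Finset.sum_add_distrib,
      ← Finset.mul_sum]
    ring
  refine ⟨?_, ?_⟩
  · intro X hX Y hY p q hp hq hpq i hi
    rw [key]
    exact (charging_aux a ha (hX i hi) (hY i hi) hp hq hpq).1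
  · intro X hX Y hY p q hp hq hpq
    simp only [smul_eq_mul]
    rw [Finset.mul_sum, Finset.mul_sum, ← Finset.sum_add_distrib]
    refine Finset.sum_le_sum fun i hi => ?_
    rw [key]
    have h := mul_le_mul_of_nonneg_left
      (charging_aux a ha (hX i hi) (hY i hi) hp hq hpq).2 (hc i hi)
    simp only [div_eq_mul_inv]
    refine h.trans (le_of_eq ?_)
    ring
end

section
/- Convexity part of Lemma 2 (heterogeneous fleet). Fix N, E, τ ∈ ℕ, a set σ ⊆ Fin N, reals a > 0, θ ≥ 0, β ∈ ℝ, cost matrices w, w* : Fin N → Fin N → ℝ, and nonnegative parameters c_{e,i}^k ≥ 0 for e ∈ Fin E, i ∈ σ, k ∈ Fin τ. For decision families x, y : Fin E → Fin τ → Matrix (Fin N) (Fin N) ℝ define T_{e,i}^k(y) = Σ_j y_e^k j i − Σ_j y_e^k i j, and define the objective J'(x, y) = Σ_e Σ_k Σ_i Σ_j (x_e^k i j · w i j + β · y_e^k i j · w* i j) + θ · Σ_k Σ_{i ∈ σ} (Σ_e c_{e,i}^k) / (Σ_e T_{e,i}^k(y))^a. Then J' is convex on the convex set of decision families (x, y)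 satisfying Σ_e T_{e,i}^k(y) > 0 for all i ∈ σ and k ∈ Fin τ. -/
lemma rpow_neg_jensen {a : ℝ} (ha : 0 < a) {x y s t : ℝ} (hx : 0 < x) (hy : 0 < y)
    (hs : 0 ≤ s) (ht : 0 ≤ t) (hst : s + t = 1) :
    (s * x + t * y) ^ (-a) ≤ s * x ^ (-a) + t * y ^ (-a) := by
  have hpos : 0 < s * x + t * y := by
    have := (convex_Ioi (0 : ℝ)) hx hy hs ht hst
    simpa using this
  have h1 := strictConcaveOn_log_Ioi.concaveOn.2 hx hy hs ht hst
  have h2 := convexOn_exp.2 (Set.mem_univ (Real.log x * -a)) (Set.mem_univ (Real.log y * -a))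
    hs ht hst
  simp only [smul_eq_mul] at h1 h2
  rw [Real.rpow_def_of_pos hpos, Real.rpow_def_of_pos hx, Real.rpow_def_of_pos hy]
  refine le_trans (Real.exp_le_exp.2 ?_) h2
  nlinarith

/-- Convexity part of Lemma 2 (heterogeneous fleet).  The objective
`J'(x, y) = ∑ e k i j, (x e k i j * w i j + β * y e k i j * w* i j)
  + θ * ∑ k, ∑ i ∈ σ, (∑ e, c e i k) / (∑ e, T e i k (y)) ^ a`,
where `T e i k (y) = ∑ j, y e k j i - ∑ j, y e k i j`, is convex on the convex set
of decision families `(x, y)` satisfying `0 < ∑ e, T e i k (y)` for all `i ∈ σ`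
and all `k`. -/
theorem convexOn_heterogeneous_objective (N E τ : ℕ) (σ : Finset (Fin N))
    (a : ℝ) (ha : 0 < a) (θ : ℝ) (hθ : 0 ≤ θ) (β : ℝ)
    (w wstar : Fin N → Fin N → ℝ)
    (c : Fin E → Fin N → Fin τ → ℝ) (hc : ∀ e : Fin E, ∀ i ∈ σ, ∀ k : Fin τ, 0 ≤ c e i k) :
    ConvexOn ℝ
      {p : (Fin E → Fin τ → Matrix (Fin N) (Fin N) ℝ) ×
           (Fin E → Fin τ → Matrix (Fin N) (Fin N) ℝ) |
        ∀ i ∈ σ, ∀ k : Fin τ,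
          0 < ∑ e, ((∑ j, p.2 e k j i) - (∑ j, p.2 e k i j))}
      (fun p =>
        (∑ e, ∑ k, ∑ i, ∑ j, (p.1 e k i j * w i j + β * p.2 e k i j * wstar i j)) +
          θ * ∑ k, ∑ i ∈ σ,
            (∑ e, c e i k) / (∑ e, ((∑ j, p.2 e k j i) - (∑ j, p.2 e k i j))) ^ a) := by
  have hT : ∀ (p q : (Fin E → Fin τ → Matrix (Fin N) (Fin N) ℝ) ×
           (Fin E → Fin τ → Matrix (Fin N) (Fin N) ℝ)) (s t : ℝ) (i : Fin N) (k : Fin τ),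
      ∑ e, ((∑ j, (s • p + t • q).2 e k j i) - (∑ j, (s • p + t • q).2 e k i j)) =
      s * ∑ e, ((∑ j, p.2 e k j i) - (∑ j, p.2 e k i j)) +
      t * ∑ e, ((∑ j, q.2 e k j i) - (∑ j, q.2 e k i j)) := by
    intro p q s t i k
    rw [Finset.mul_sum, Finset.mul_sum, ← Finset.sum_add_distrib]
    refine Finset.sum_congr rfl fun e _ => ?_
    simp only [Prod.snd_add, Prod.smul_snd, Pi.add_apply, Pi.smul_apply, Matrix.add_apply,
      Matrix.smul_apply, smul_eq_mul, Finset.sum_add_distrib, ← Finset.mul_sum]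
    ring
  refine ⟨?_, ?_⟩
  · intro p hp q hq s t hs ht hst i hi k
    rw [hT]
    have := (convex_Ioi (0 : ℝ)) (hp i hi k) (hq i hi k) hs ht hst
    simpa only [smul_eq_mul, Set.mem_Ioi] using this
  · intro p hp q hq s t hs ht hst
    simp only [hT]
    have hlin : (∑ e, ∑ k, ∑ i, ∑ j, ((s • p + t • q).1 e k i j * w i j +
          β * (s • p + t • q).2 e k i j * wstar i j)) =
        s * (∑ e, ∑ k, ∑ i, ∑ j, (p.1 e k i j * w i j + β * p.2 e k i j * wstar i j)) +
        t * (∑ e, ∑ k, ∑ i, ∑ j, (q.1 e k i j * w i j + β * q.2 e k i j * wstar i j)) := by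
      simp only [Finset.mul_sum, ← Finset.sum_add_distrib]
      refine Finset.sum_congr rfl fun e _ => Finset.sum_congr rfl fun k _ =>
        Finset.sum_congr rfl fun i _ => Finset.sum_congr rfl fun j _ => ?_
      simp only [Prod.snd_add, Prod.smul_snd, Prod.fst_add, Prod.smul_fst, Pi.add_apply,
        Pi.smul_apply, Matrix.add_apply, Matrix.smul_apply, smul_eq_mul]
      ring
    have hfair : (∑ k, ∑ i ∈ σ, (∑ e, c e i k) /
          (s * ∑ e, ((∑ j, p.2 e k j i) - (∑ j, p.2 e k i j)) +
            t * ∑ e, ((∑ j, q.2 e k j i) - (∑ j, q.2 e k i j))) ^ a) ≤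
        s * (∑ k, ∑ i ∈ σ, (∑ e, c e i k) /
          (∑ e, ((∑ j, p.2 e k j i) - (∑ j, p.2 e k i j))) ^ a) +
        t * (∑ k, ∑ i ∈ σ, (∑ e, c e i k) /
          (∑ e, ((∑ j, q.2 e k j i) - (∑ j, q.2 e k i j))) ^ a) := by
      rw [Finset.mul_sum, Finset.mul_sum, ← Finset.sum_add_distrib]
      refine Finset.sum_le_sum fun k _ => ?_
      rw [Finset.mul_sum, Finset.mul_sum, ← Finset.sum_add_distrib]
      refine Finset.sum_le_sum fun i hi => ?_
      have hx := hp i hi k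
      have hy := hq i hi k
      have hC : 0 ≤ ∑ e, c e i k := Finset.sum_nonneg fun e _ => hc e i hi k
      generalize (∑ e, ((∑ j, p.2 e k j i) - (∑ j, p.2 e k i j))) = X at *
      generalize (∑ e, ((∑ j, q.2 e k j i) - (∑ j, q.2 e k i j))) = Y at *
      have hpos : 0 < s * X + t * Y := by
        have := (convex_Ioi (0 : ℝ)) hx hy hs ht hst
        simpa using this
      have h := mul_le_mul_of_nonneg_left (rpow_neg_jensen ha hx hy hs ht hst) hC
      rw [Real.rpow_neg hpos.le, Real.rpow_neg hx.le, Real.rpow_neg hy.le] at h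
      simp only [div_eq_mul_inv]
      linarith
    rw [hlin]
    have h := mul_le_mul_of_nonneg_left hfair hθ
    simp only [smul_eq_mul]
    linarith
end
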